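/- arXiv:2603.16304 — 6 statements merged into one kernel-verified Lean document; each statement's English description precedes it below -/
import Mathlib

section
/- For all integers n ≥ 1 and all k with 1 ≤ k ≤ n, the function L satisfies the sandpile gambler's ruin recurrence L(n,k) = (1/3)·(L(n,k−1) + L(n,k+1) + L(n−k,1)·L(n,k−1)), together with the boundary conditions L(n,0) = 1 and L(n,n+1) = 0 for every n ≥ 0. -/
/-- Closed form of the left-exit sandpile gambler's ruin probability:
`L n k = (n-k+1)(n-k+2)/((n+1)(n+2))`. -/
noncomputable def sgrL (n k : ℤ) : ℚ :=
  ((n - k + 1) * (n - k + 2) : ℤ) / ((n + 1) * (n + 2) : ℤ)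

/-- The closed form `L` satisfies the sandpile gambler's ruin recurrence together with
the boundary conditions `L(n,0) = 1` and `L(n,n+1) = 0`. -/
theorem sgrL_recurrence_and_boundary :
    (∀ n k : ℤ, 1 ≤ n → 1 ≤ k → k ≤ n →
      sgrL n k = (1 / 3) * (sgrL n (k - 1) + sgrL n (k + 1) + sgrL (n - k) 1 * sgrL n (k - 1)))
    ∧ (∀ n : ℤ, 0 ≤ n → sgrL n 0 = 1)
    ∧ (∀ n : ℤ, 0 ≤ n → sgrL n (n + 1) = 0) := by
  refine ⟨fun n k hn _ hkn => ?_, fun n hn => ?_, fun n _ => ?_⟩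
  · obtain ⟨m, rfl⟩ : ∃ m, k = n - m := ⟨n - k, by ring⟩
    have hn' : (1 : ℚ) ≤ n := by exact_mod_cast hn
    have hm' : (0 : ℚ) ≤ m := by
      have hm : 0 ≤ m := by linarith
      exact_mod_cast hm
    have h₁ : (n : ℚ) + 1 ≠ 0 := by positivity
    have h₂ : (n : ℚ) + 2 ≠ 0 := by positivity
    have h₃ : (m : ℚ) + 1 ≠ 0 := by positivity
    have h₄ : (m : ℚ) + 2 ≠ 0 := by positivity
    simp only [sgrL, sub_sub_cancel]
    push_cast
    field_simp
    ring
  · have hn' : (0 : ℚ) ≤ n := by exact_mod_cast hn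
    have h : ((n : ℚ) + 1) * (n + 2) ≠ 0 := by positivity
    simp only [sgrL, sub_zero]
    push_cast
    exact div_self h
  · simp [sgrL]
end

section
/- Suppose f assigns a real number f(n,k) to every pair of integers n ≥ 0 and 0 ≤ k ≤ n+1, satisfies the boundary conditions f(n,0) = 1 and f(n,n+1) = 0 for all n ≥ 0, and satisfies the recurrence f(n,k) = (1/3)·(f(n,k−1) + f(n,k+1) + f(n−k,1)·f(n,k−1)) for all n ≥ 1 and 1 ≤ k ≤ n. Then f(n,k) = (n−k+1)(n−k+2)/((n+1)(n+2)) for all n ≥ 0 and 0 ≤ k ≤ n+1; that is, the recurrence together with the boundary conditions has a unique solution, given by this closed form. -/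
/-- A sequence with `d (k + 2) = 3 d (k + 1) - c k d k`, `0 ≤ c k ≤ 2`, that vanishes at
`0` and at `N` vanishes on `{0, …, N}`, since `|d|` is nondecreasing there. -/
theorem eq_zero_of_three_term_recurrence (d c : ℕ → ℝ) (N : ℕ)
    (h0 : d 0 = 0) (hN : d N = 0)
    (hc : ∀ k, k + 2 ≤ N → 0 ≤ c k ∧ c k ≤ 2)
    (hd : ∀ k, k + 2 ≤ N → d (k + 2) = 3 * d (k + 1) - c k * d k) :
    ∀ k, k ≤ N → d k = 0 := by
  have mono : ∀ k, k + 1 ≤ N → |d k| ≤ |d (k + 1)| := by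
    intro k
    induction k with
    | zero => simp [h0]
    | succ k ih =>
      intro hk
      have hle := ih (by lia)
      obtain ⟨hc0, hc2⟩ := hc k hk
      have hbound : |c k * d k| ≤ 2 * |d k| := by
        rw [abs_mul, abs_of_nonneg hc0]
        gcongr
      have htri := abs_sub_abs_le_abs_sub (3 * d (k + 1)) (c k * d k)
      rw [← hd k hk, abs_mul, abs_of_pos (by norm_num : (0 : ℝ) < 3)] at htri
      change |d (k + 1)| ≤ |d (k + 2)|
      linarith
  intro k hk
  induction hk using Nat.decreasingInduction with
  | self => exact hN
  | of_succ k hk ih =>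
    have h := mono k hk
    rw [ih, abs_zero] at h
    exact abs_nonpos_iff.mp h

/-- Any real-valued solution of the sandpile gambler's ruin recurrence with the
boundary conditions `f(n,0) = 1`, `f(n,n+1) = 0` coincides with the closed form
`(n-k+1)(n-k+2)/((n+1)(n+2))` on its whole domain. -/
theorem sgr_recurrence_unique_solution (f : ℤ → ℤ → ℝ)
    (hbd0 : ∀ n : ℤ, 0 ≤ n → f n 0 = 1)
    (hbd1 : ∀ n : ℤ, 0 ≤ n → f n (n + 1) = 0)
    (hrec : ∀ n k : ℤ, 1 ≤ n → 1 ≤ k → k ≤ n →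
      f n k = (1 / 3) * (f n (k - 1) + f n (k + 1) + f (n - k) 1 * f n (k - 1))) :
    ∀ n k : ℤ, 0 ≤ n → 0 ≤ k → k ≤ n + 1 →
      f n k = ((n : ℝ) - k + 1) * ((n : ℝ) - k + 2) / (((n : ℝ) + 1) * ((n : ℝ) + 2)) := by
  intro n k hn
  lift n to ℕ using hn
  induction n using Nat.strong_induction_on generalizing k with
  | _ n ih =>
  intro hk hkn
  lift k to ℕ using hk
  push_cast
  rw [← sub_eq_zero]
  refine eq_zero_of_three_term_recurrence
    (fun j ↦ f n j - ((n : ℝ) - j + 1) * ((n : ℝ) - j + 2) / (((n : ℝ) + 1) * ((n : ℝ) + 2)))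
    (fun j ↦ 1 + f (n - (j + 1)) 1) (n + 1) ?_ ?_ ?_ ?_ k (by lia)
  · have h := hbd0 n (by positivity)
    simp only [Nat.cast_zero, h]
    field_simp
    ring
  · have h := hbd1 n (by positivity)
    push_cast
    rw [h]
    ring
  all_goals
    intro j hj
    obtain ⟨m, rfl⟩ : ∃ m, n = m + (j + 1) := ⟨n - (j + 1), by lia⟩
    have hm := ih m (by lia) 1 (by lia) (by lia)
    have hsub : ((m + (j + 1) : ℕ) : ℤ) - (j + 1) = m := by push_cast; ring
    have hval : f m 1 = (m : ℝ) / (m + 2) := by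
      rw [hm]
      push_cast
      field_simp
      ring
    simp only [hsub, hval]
  · have h1 : (m : ℝ) / (m + 2) ≤ 1 := by
      rw [div_le_one (by positivity)]
      linarith
    have h0 : 0 ≤ (m : ℝ) / (m + 2) := by positivity
    constructor <;> linarith
  · have h := hrec (m + (j + 1) : ℕ) (j + 1) (by lia) (by lia) (by lia)
    rw [hsub, hval, add_sub_cancel_right, add_assoc (j : ℤ), one_add_one_eq_two] at h
    have hnext : f (m + (j + 1) : ℕ) (j + 2) = 3 * f (m + (j + 1) : ℕ) (j + 1)
        - (1 + (m : ℝ) / (m + 2)) * f (m + (j + 1) : ℕ) j := by linarith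
    rw [Nat.cast_add j 2, Nat.cast_add j 1, Nat.cast_ofNat, Nat.cast_one, hnext]
    push_cast
    field_simp
    ring
end

section
/- For all integers n ≥ 1 and 1 ≤ j ≤ n, it holds that (1/n)·(1 + ∑_{i=1}^{j−1} R(j−1, i) + ∑_{i=1}^{n−j} L(n−j, i)) = (n+2)/(3n), where L and R are the closed-form gambler's ruin expressions. (This is the transition probability of the stochastic sandpile Markov chain on {1,…,n} from the configuration with a hole at j to the full configuration.) -/
/-- Closed form of the right-exit probability. -/
noncomputable def sgrR (n k : ℤ) : ℚ :=
  ((k * (k + 1) : ℤ) : ℚ) / (((n + 1) * (n + 2) : ℤ) : ℚ)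

theorem sum_Icc_int_mul_succ (m : ℕ) :
    ∑ i ∈ Finset.Icc (1 : ℤ) m, (i : ℚ) * (i + 1) = m * (m + 1) * (m + 2) / 3 := by
  induction m with
  | zero => simp
  | succ m ih =>
    have h : Finset.Icc (1 : ℤ) ((m + 1 : ℕ) : ℤ)
        = insert ((m : ℤ) + 1) (Finset.Icc (1 : ℤ) (m : ℤ)) := by
      ext x
      simp only [Finset.mem_Icc, Finset.mem_insert]
      omega
    rw [h, Finset.sum_insert (by simp), ih]
    push_cast
    ring

theorem sum_sgrR (m : ℤ) (hm : 0 ≤ m) : ∑ i ∈ Finset.Icc (1 : ℤ) m, sgrR m i = m / 3 := by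
  lift m to ℕ using hm
  simp only [sgrR]
  push_cast
  rw [← Finset.sum_div, sum_Icc_int_mul_succ]
  field_simp

theorem sgrL_eq_sgrR_reflect (m k : ℤ) : sgrL m k = sgrR m (m + 1 - k) := by
  simp only [sgrL, sgrR]
  push_cast
  ring

theorem sum_sgrL (m : ℤ) (hm : 0 ≤ m) : ∑ i ∈ Finset.Icc (1 : ℤ) m, sgrL m i = m / 3 := by
  rw [← sum_sgrR m hm]
  refine Finset.sum_nbij' (fun i => m + 1 - i) (fun i => m + 1 - i) ?_ ?_ ?_ ?_
    fun i _ => sgrL_eq_sgrR_reflect m i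
  all_goals
    intro i hi
    simp only [Finset.mem_Icc] at hi ⊢
    omega


/-- The transition probability of the stochastic sandpile Markov chain on `{1,…,n}`
from the configuration with a hole at `j` to the full configuration is `(n+2)/(3n)`. -/
theorem transition_hole_to_full (n j : ℤ) (hn : 1 ≤ n) (hj1 : 1 ≤ j) (hjn : j ≤ n) :
    (1 / (n : ℚ)) * (1 + (∑ i ∈ Finset.Icc (1 : ℤ) (j - 1), sgrR (j - 1) i)
        + ∑ i ∈ Finset.Icc (1 : ℤ) (n - j), sgrL (n - j) i)
      = ((n : ℚ) + 2) / (3 * n) := by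
  rw [sum_sgrR _ (by omega), sum_sgrL _ (by omega)]
  have hn0 : (n : ℚ) ≠ 0 := by
    exact_mod_cast (by omega : n ≠ 0)
  push_cast
  field_simp
  ring
end

section
/- Let n ≥ 1 be an integer and let ν = (ν(0), ν(1), …, ν(n)) be a probability vector (all entries nonnegative, summing to 1) that is stationary for P, i.e. ∑_{j=0}^{n} ν(j)·P(j,i) = ν(i) for all i ∈ {0,…,n}. Then ν(0) = 1/2 + 1/(2(n+1)). -/
/-- The transition matrix of the stochastic sandpile Markov chain on `{1,…,n}`
restricted to its recurrent configurations; state `0` is the full configuration,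
state `j ∈ {1,…,n}` is the configuration with a hole at `j`. -/
noncomputable def sandP (n : ℕ) (j i : ℕ) : ℝ :=
  if j = 0 then (if i = 0 then 2 / 3 else 1 / (3 * (n : ℝ)))
  else if i = 0 then ((n : ℝ) + 2) / (3 * (n : ℝ))
  else if i = j then ((n : ℝ) - 1) / (3 * (n : ℝ))
  else 1 / (3 * (n : ℝ))

/-- Any stationary probability vector of the sandpile transition matrix gives the
full configuration probability `1/2 + 1/(2(n+1))`. -/
theorem stationary_mass_full (n : ℕ) (hn : 1 ≤ n) (ν : ℕ → ℝ)
    (hnonneg : ∀ j : ℕ, j ≤ n → 0 ≤ ν j)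
    (hsum : ∑ j ∈ Finset.range (n + 1), ν j = 1)
    (hstat : ∀ i : ℕ, i ≤ n → ∑ j ∈ Finset.range (n + 1), ν j * sandP n j i = ν i) :
    ν 0 = 1 / 2 + 1 / (2 * ((n : ℝ) + 1)) := by
  have h0 := hstat 0 (Nat.zero_le n)
  have hpos : (0 : ℝ) < n := by exact_mod_cast hn
  rw [Finset.sum_range_succ'] at hsum h0
  simp only [sandP, Nat.add_eq_zero_iff, one_ne_zero, and_false, if_false, if_true] at h0
  rw [← Finset.sum_mul, eq_sub_of_add_eq hsum] at h0
  field_simp at h0 ⊢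
  linarith
end

section
/- Let n ≥ 1 be an integer and let ν = (ν(0), ν(1), …, ν(n)) be a probability vector (all entries nonnegative, summing to 1) that is stationary for P, i.e. ∑_{j=0}^{n} ν(j)·P(j,i) = ν(i) for all i ∈ {0,…,n}. Then ν(i) = 1/(2(n+1)) for every i ∈ {1,…,n}; in particular the stationary distribution is uniform on the vacant configurations. -/
/-- A column of `sandP` indexed by a vacant configuration is constant up to a correction
on the diagonal. -/
lemma sandP_of_ne_zero (n j : ℕ) {i : ℕ} (hi : i ≠ 0) :
    sandP n j i = 1 / (3 * (n : ℝ)) + if j = i then ((n : ℝ) - 2) / (3 * (n : ℝ)) else 0 := by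
  rcases eq_or_ne j i with rfl | hji
  · simp only [sandP, if_neg hi, if_true]
    ring
  · simp [sandP, hi, hji, hji.symm]

/-- Any stationary probability vector of the sandpile transition matrix is uniform on
the vacant configurations: `ν(i) = 1/(2(n+1))` for every `i ∈ {1,…,n}`. -/
theorem stationary_uniform_on_vacant (n : ℕ) (hn : 1 ≤ n) (ν : ℕ → ℝ)
    (hnonneg : ∀ j : ℕ, j ≤ n → 0 ≤ ν j)
    (hsum : ∑ j ∈ Finset.range (n + 1), ν j = 1)
    (hstat : ∀ i : ℕ, i ≤ n → ∑ j ∈ Finset.range (n + 1), ν j * sandP n j i = ν i) :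
    ∀ i : ℕ, 1 ≤ i → i ≤ n → ν i = 1 / (2 * ((n : ℝ) + 1)) := by
  intro i hi hin
  have hn0 : (n : ℝ) ≠ 0 := by positivity
  have h := hstat i hin
  simp only [sandP_of_ne_zero n _ (Nat.one_le_iff_ne_zero.mp hi), mul_add, mul_ite, mul_zero,
    Finset.sum_add_distrib, ← Finset.sum_mul, hsum, Finset.sum_ite_eq', Finset.mem_range,
    Nat.lt_succ_of_le hin, if_true] at h
  field_simp at h
  rw [eq_div_iff (by positivity)]
  linarith
end

section
/- For every integer n ≥ 1, the vector μ defined by μ(0) = 1/2 + 1/(2(n+1)) and μ(i) = 1/(2(n+1)) for i ∈ {1,…,n} is a probability vector (nonnegative entries summing to 1) and is stationary for P, i.e. ∑_{j=0}^{n} μ(j)·P(j,i) = μ(i) for all i ∈ {0,…,n}. -/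
/-- The candidate stationary vector: `μ(0) = 1/2 + 1/(2(n+1))` for the full
configuration and `μ(i) = 1/(2(n+1))` for each vacant configuration. -/
noncomputable def sandMu (n : ℕ) (i : ℕ) : ℝ :=
  if i = 0 then 1 / 2 + 1 / (2 * ((n : ℝ) + 1)) else 1 / (2 * ((n : ℝ) + 1))

/-- The vector `sandMu n` is a probability vector and is stationary for the sandpile
transition matrix. -/
theorem sandMu_is_stationary (n : ℕ) (hn : 1 ≤ n) :
    (∀ i : ℕ, i ≤ n → 0 ≤ sandMu n i)
    ∧ (∑ i ∈ Finset.range (n + 1), sandMu n i = 1)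
    ∧ (∀ i : ℕ, i ≤ n →
        ∑ j ∈ Finset.range (n + 1), sandMu n j * sandP n j i = sandMu n i) := by
  have hn0 : (n : ℝ) ≠ 0 := by
    have : n ≠ 0 := by omega
    exact_mod_cast this
  have hn1 : (n : ℝ) + 1 ≠ 0 := by positivity
  refine ⟨fun i _ => ?_, ?_, fun i hi => ?_⟩
  · unfold sandMu
    split_ifs <;> positivity
  · rw [Finset.sum_range_succ']
    simp only [sandMu, Nat.succ_ne_zero, if_true, if_false, Finset.sum_const,
      Finset.card_range, nsmul_eq_mul]
    field_simp
    ring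
  · rw [Finset.sum_range_succ']
    rcases i with _ | k
    · simp only [sandMu, sandP, Nat.succ_ne_zero, if_true, if_false, Finset.sum_const,
        Finset.card_range, nsmul_eq_mul]
      field_simp
      ring
    · have hterm : ∀ j ∈ Finset.range n, sandMu n (j + 1) * sandP n (j + 1) (k + 1) =
          1 / (2 * ((n : ℝ) + 1)) * (1 / (3 * (n : ℝ))) +
            if k = j then 1 / (2 * ((n : ℝ) + 1)) * (((n : ℝ) - 2) / (3 * (n : ℝ))) else 0 := by
        intro j _
        simp only [sandMu, sandP, Nat.succ_ne_zero, if_false, Nat.add_right_cancel_iff]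
        split_ifs <;> ring
      rw [Finset.sum_congr rfl hterm, Finset.sum_add_distrib, Finset.sum_ite_eq,
        if_pos (Finset.mem_range.2 (by omega))]
      simp only [sandMu, sandP, Nat.succ_ne_zero, if_true, if_false, Finset.sum_const,
        Finset.card_range, nsmul_eq_mul]
      field_simp
      ring
end
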